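/- For every real c, λ(c)(c + λ(c)) < 1. Consequently the derivative of the inverse Mills ratio satisfies −1 < λ'(c) < 0, so |λ'(c)| ≤ 1 for every real c, and d(c) := 1 − λ(c)(c + λ(c)) lies strictly between 0 and 1. -/

import Mathlib

open MeasureTheory ProbabilityTheory Real Set

/-- The standard normal density φ(x) = (2π)^{-1/2} exp(-x²/2). -/
noncomputable def stdNormalPDF (x : ℝ) : ℝ :=
  (Real.sqrt (2 * Real.pi))⁻¹ * Real.exp (-x ^ 2 / 2)

/-- The standard normal cumulative distribution function Φ(x) = ∫_{-∞}^{x} φ(t) dt. -/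
noncomputable def stdNormalCDF (x : ℝ) : ℝ :=
  ∫ t in Set.Iic x, stdNormalPDF t

/-- The inverse Mills ratio λ(x) = φ(x)/Φ(x). -/
noncomputable def invMills (x : ℝ) : ℝ := stdNormalPDF x / stdNormalCDF x

lemma stdNormalPDF_pos (x : ℝ) : 0 < stdNormalPDF x := by
  unfold stdNormalPDF
  positivity

lemma hasDerivAt_stdNormalPDF (x : ℝ) : HasDerivAt stdNormalPDF (-(x * stdNormalPDF x)) x := by
  have h : HasDerivAt (fun t : ℝ => -t ^ 2 / 2) (-x) x := by
    have h' := ((hasDerivAt_pow 2 x).neg).div_const 2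
    exact h'.congr_deriv (by push_cast; ring)
  have h2 := h.exp.const_mul (Real.sqrt (2 * Real.pi))⁻¹
  refine h2.congr_deriv ?_
  unfold stdNormalPDF
  ring

lemma continuous_stdNormalPDF : Continuous stdNormalPDF := by
  unfold stdNormalPDF
  fun_prop

lemma integrable_pow_mul_stdNormalPDF (n : ℕ) :
    Integrable (fun t : ℝ => t ^ n * stdNormalPDF t) := by
  have hn : (-1 : ℝ) < (n : ℝ) := by
    have : (0 : ℝ) ≤ n := n.cast_nonneg
    linarith
  have h := (integrable_rpow_mul_exp_neg_mul_sq (b := 1 / 2) (by norm_num) hn).const_mul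
    (Real.sqrt (2 * Real.pi))⁻¹
  refine h.congr (Filter.Eventually.of_forall fun t => ?_)
  simp only [stdNormalPDF, Real.rpow_natCast]
  rw [show -t ^ 2 / 2 = -(1 / 2) * t ^ 2 by ring]
  ring

lemma integrable_stdNormalPDF : Integrable stdNormalPDF := by
  simpa using integrable_pow_mul_stdNormalPDF 0

lemma integrable_mul_stdNormalPDF : Integrable (fun t : ℝ => t * stdNormalPDF t) := by
  simpa using integrable_pow_mul_stdNormalPDF 1

/-- The fundamental theorem of calculus on a left half-line: if a function and its derivative are
both integrable, there is no boundary term at `-∞`. -/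
lemma integral_Iic_of_hasDerivAt_of_integrable {f f' : ℝ → ℝ} (hderiv : ∀ x, HasDerivAt f (f' x) x)
    (hf' : Integrable f') (hf : Integrable f) (c : ℝ) : ∫ t in Iic c, f' t = f c := by
  have hlim := tendsto_zero_of_hasDerivAt_of_integrableOn_Iic (a := c)
    (fun x _ => hderiv x) hf'.integrableOn hf.integrableOn
  simpa using integral_Iic_of_hasDerivAt_of_tendsto' (a := c)
    (fun x _ => hderiv x) hf'.integrableOn hlim

lemma integral_Iic_mul_stdNormalPDF (c : ℝ) :
    ∫ t in Iic c, t * stdNormalPDF t = -stdNormalPDF c := by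
  have h := integral_Iic_of_hasDerivAt_of_integrable hasDerivAt_stdNormalPDF
    integrable_mul_stdNormalPDF.neg integrable_stdNormalPDF c
  rw [integral_neg] at h
  linarith

lemma integral_Iic_sq_mul_stdNormalPDF (c : ℝ) :
    ∫ t in Iic c, t ^ 2 * stdNormalPDF t = stdNormalCDF c - c * stdNormalPDF c := by
  have hderiv : ∀ x : ℝ, HasDerivAt (fun t => t * stdNormalPDF t)
      (stdNormalPDF x - x ^ 2 * stdNormalPDF x) x := fun x => by
    refine ((hasDerivAt_id x).mul (hasDerivAt_stdNormalPDF x)).congr_deriv ?_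
    simp only [id]
    ring
  have h := integral_Iic_of_hasDerivAt_of_integrable hderiv
    (integrable_stdNormalPDF.sub (integrable_pow_mul_stdNormalPDF 2))
    integrable_mul_stdNormalPDF c
  rw [integral_sub integrable_stdNormalPDF.integrableOn
    (integrable_pow_mul_stdNormalPDF 2).integrableOn] at h
  unfold stdNormalCDF
  linarith

lemma integral_Iic_pos_of_nonneg_of_ne {f : ℝ → ℝ} {c p : ℝ} (hf : IntegrableOn f (Iic c))
    (hnonneg : ∀ t ≤ c, 0 ≤ f t) (hne : ∀ t, t ≠ p → f t ≠ 0) : 0 < ∫ t in Iic c, f t := by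
  rw [setIntegral_pos_iff_support_of_nonneg_ae
    (ae_restrict_of_forall_mem measurableSet_Iic hnonneg) hf]
  have hsub : Iic c \ {p} ⊆ Function.support f ∩ Iic c := fun t ht => ⟨hne t ht.2, ht.1⟩
  refine lt_of_lt_of_le ?_ (measure_mono hsub)
  rw [measure_sdiff_null (by simp)]
  simp

lemma stdNormalCDF_pos (c : ℝ) : 0 < stdNormalCDF c :=
  integral_Iic_pos_of_nonneg_of_ne (p := c) integrable_stdNormalPDF.integrableOn
    (fun t _ => (stdNormalPDF_pos t).le) (fun t _ => (stdNormalPDF_pos t).ne')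

lemma hasDerivAt_stdNormalCDF (c : ℝ) : HasDerivAt stdNormalCDF (stdNormalPDF c) c := by
  have h : HasDerivAt (fun x => stdNormalCDF 0 + ∫ t in (0 : ℝ)..x, stdNormalPDF t)
      (stdNormalPDF c) c :=
    (continuous_stdNormalPDF.integral_hasStrictDerivAt 0 c).hasDerivAt.const_add _
  refine h.congr_of_eventuallyEq (Filter.Eventually.of_forall fun x => ?_)
  beta_reduce
  rw [← intervalIntegral.integral_Iic_sub_Iic integrable_stdNormalPDF.integrableOn
    integrable_stdNormalPDF.integrableOn]
  unfold stdNormalCDF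
  ring

lemma invMills_pos (c : ℝ) : 0 < invMills c :=
  div_pos (stdNormalPDF_pos c) (stdNormalCDF_pos c)

lemma stdNormalPDF_eq_invMills_mul (c : ℝ) : stdNormalPDF c = invMills c * stdNormalCDF c :=
  (div_mul_cancel₀ _ (stdNormalCDF_pos c).ne').symm

lemma hasDerivAt_invMills (c : ℝ) :
    HasDerivAt invMills (-(invMills c * (c + invMills c))) c := by
  have hΦ := (stdNormalCDF_pos c).ne'
  refine ((hasDerivAt_stdNormalPDF c).div (hasDerivAt_stdNormalCDF c) hΦ).congr_deriv ?_
  unfold invMills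
  field_simp
  ring

/-- The mean of `c - t` under the standard normal law truncated to `t ≤ c` is positive. -/
lemma add_invMills_pos (c : ℝ) : 0 < c + invMills c := by
  have hint : IntegrableOn (fun t => c * stdNormalPDF t - t * stdNormalPDF t) (Iic c) :=
    ((integrable_stdNormalPDF.const_mul c).sub integrable_mul_stdNormalPDF).integrableOn
  have h := integral_Iic_pos_of_nonneg_of_ne (p := c) hint
    (fun t ht => by
      rw [← sub_mul]
      exact mul_nonneg (sub_nonneg.2 ht) (stdNormalPDF_pos t).le)
    (fun t ht => by
      rw [← sub_mul]
      exact mul_ne_zero (sub_ne_zero.2 ht.symm) (stdNormalPDF_pos t).ne')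
  rw [integral_sub (integrable_stdNormalPDF.const_mul c).integrableOn
    integrable_mul_stdNormalPDF.integrableOn, integral_const_mul,
    integral_Iic_mul_stdNormalPDF, stdNormalPDF_eq_invMills_mul] at h
  change 0 < c * stdNormalCDF c - _ at h
  refine pos_of_mul_pos_left ?_ (stdNormalCDF_pos c).le
  linarith

/-- The variance of the standard normal law truncated to `t ≤ c` is positive. -/
lemma one_sub_invMills_mul_pos (c : ℝ) : 0 < 1 - invMills c * (c + invMills c) := by
  have h0 := (integrable_stdNormalPDF.const_mul (invMills c ^ 2)).integrableOn (s := Iic c)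
  have h1 := (integrable_mul_stdNormalPDF.const_mul (2 * invMills c)).integrableOn (s := Iic c)
  have h2 := (integrable_pow_mul_stdNormalPDF 2).integrableOn (s := Iic c)
  have hsq : ∀ t, t ^ 2 * stdNormalPDF t + 2 * invMills c * (t * stdNormalPDF t) +
      invMills c ^ 2 * stdNormalPDF t = (t + invMills c) ^ 2 * stdNormalPDF t := fun t => by ring
  have h := integral_Iic_pos_of_nonneg_of_ne (p := -invMills c) ((h2.add h1).add h0)
    (fun t _ => (mul_nonneg (sq_nonneg _) (stdNormalPDF_pos t).le).trans_eq (hsq t).symm)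
    (fun t ht => (hsq t).trans_ne <| mul_ne_zero
      (pow_ne_zero 2 fun h => ht (eq_neg_of_add_eq_zero_left h)) (stdNormalPDF_pos t).ne')
  rw [integral_add' (h2.add h1) h0, integral_add' h2 h1, integral_const_mul, integral_const_mul,
    integral_Iic_mul_stdNormalPDF, integral_Iic_sq_mul_stdNormalPDF,
    stdNormalPDF_eq_invMills_mul] at h
  change 0 < _ + invMills c ^ 2 * stdNormalCDF c at h
  refine pos_of_mul_pos_left ?_ (stdNormalCDF_pos c).le
  linarith

/-- For every real `c`, `λ(c)(c + λ(c)) < 1`; consequently `−1 < λ'(c) < 0`, so `|λ'(c)| ≤ 1`,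
and `d(c) := 1 − λ(c)(c + λ(c))` lies strictly between `0` and `1`. -/
theorem invMills_deriv_bounds (c : ℝ) :
    invMills c * (c + invMills c) < 1 ∧
      (-1 < deriv invMills c ∧ deriv invMills c < 0) ∧
      |deriv invMills c| ≤ 1 ∧
      (0 < 1 - invMills c * (c + invMills c) ∧ 1 - invMills c * (c + invMills c) < 1) := by
  have hpos : 0 < invMills c * (c + invMills c) := mul_pos (invMills_pos c) (add_invMills_pos c)
  have hlt := one_sub_invMills_mul_pos c
  rw [(hasDerivAt_invMills c).deriv]
  refine ⟨by linarith, ⟨by linarith, by linarith⟩, ?_, hlt, by linarith⟩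
  rw [abs_le]
  constructor <;> linarith
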